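/- arXiv:1705.07493 — 3 statements merged into one kernel-verified Lean document; each statement's English description precedes it below -/
import Mathlib

section
/- Assume the connectivity assumption, let λ and c be T-periodic and locally piecewise constant, and assume the stability condition. Let (x, z) and (x̃, z̃) be solutions of the traffic flow model with the same R, δ, λ, c, both with piecewise constant initial histories. Then Σ_{i ∈ E} |x_i(t) − x̃_i(t)| → 0 and Σ_{i ∈ E} Σ_{j ∈ E} R_{ji} ∫_{t−δ_{ji}}^{t} |z_j(s) − z̃_j(s)| ds → 0 as t → ∞. -/
open MeasureTheory

variable {E : Type*}

/-- `f` is piecewise constant on the set `s`: there is a finite set `D` of breakpoints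
such that `f` is constant between consecutive breakpoints (pieces are right-open). -/
def PwcOn (f : ℝ → ℝ) (s : Set ℝ) : Prop :=
  ∃ D : Finset ℝ, ∀ u ∈ s, ∀ v ∈ s, u ≤ v → (∀ d ∈ D, d ∉ Set.Ioc u v) → f u = f v

/-- `f` is locally piecewise constant on `s`: piecewise constant on every compact
subinterval of `s`. -/
def LocPwcOn (f : ℝ → ℝ) (s : Set ℝ) : Prop :=
  ∀ a b : ℝ, PwcOn f (s ∩ Set.Icc a b)

/-- The maximum `δ̄` of the inter-link travel times over pairs `(j, i)` with `R j i > 0`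
(and `0` if there are no such pairs). -/
noncomputable def dbar (R δ : E → E → ℝ) : ℝ :=
  sSup (insert 0 {d : ℝ | ∃ j i, 0 < R j i ∧ δ j i = d})

/-- `w ∈ ℝ^E` is feasible at time `t` for the traffic flow model:
`w i ≤ c t i` for every link `i`, and for every link `i` with empty queue (`x t i = 0`),
`w i ≤ λ̃_i(t) + Σ_{j ∈ E_i} R j i * w j`, where `E_i = {j : R j i > 0 ∧ δ j i = 0}` and
`λ̃_i(t) = λ_i(t) + Σ_{j ∉ E_i} R j i * z (t - δ j i) j`. -/
def FeasibleAt (R δ : E → E → ℝ) (lam c : ℝ → E → ℝ) (x z : ℝ → E → ℝ)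
    (t : ℝ) (w : E → ℝ) [Fintype E] : Prop :=
  (∀ i, w i ≤ c t i) ∧
  ∀ i, x t i = 0 →
    w i ≤ lam t i + ∑ j, R j i * (if δ j i = 0 then w j else z (t - δ j i) j)

/-- `(x, z)` is a solution of the traffic flow model with routing matrix `R`, travel
times `δ`, external inflow `lam` and capacity `c`: queue lengths and outflows are
nonnegative, `z` is locally integrable on `[-δ̄, ∞)`, at every time `t ≥ 0` the outflow
`z t` is feasible and maximizes the cumulative outflow `Σ_i w i` among feasible vectors,
and the queue lengths satisfy the integral mass-balance equation. -/
def IsSolution [Fintype E] (R δ : E → E → ℝ) (lam c : ℝ → E → ℝ)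
    (x z : ℝ → E → ℝ) : Prop :=
  (∀ t, 0 ≤ t → ∀ i, 0 ≤ x t i) ∧
  (∀ t, -(dbar R δ) ≤ t → ∀ i, 0 ≤ z t i) ∧
  (∀ i, LocallyIntegrableOn (fun t => z t i) (Set.Ici (-(dbar R δ)))) ∧
  (∀ t, 0 ≤ t → FeasibleAt R δ lam c x z t (fun i => z t i)) ∧
  (∀ t, 0 ≤ t → ∀ w : E → ℝ, FeasibleAt R δ lam c x z t w → ∑ i, w i ≤ ∑ i, z t i) ∧
  (∀ t, 0 ≤ t → ∀ i,
    x t i = x 0 i + ∫ s in (0:ℝ)..t, (lam s i + ∑ j, R j i * z (s - δ j i) j - z s i))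

/-- Reachability in the directed graph on links with an edge from `j` to `i`
whenever `R j i > 0`. -/
def Reach (R : E → E → ℝ) : E → E → Prop :=
  Relation.TransGen fun a b => 0 < R a b

/-- Connectivity assumption: the graph is weakly connected, all row sums of `R` are at
most one, and from every link either its own row sum is less than one or a link with
row sum less than one is reachable. -/
def ConnAssumption [Fintype E] (R : E → E → ℝ) : Prop :=
  (∀ i j : E, i ≠ j → Reach R i j ∨ Reach R j i) ∧
  (∀ i : E, ∑ l, R i l ≤ 1) ∧
  (∀ i : E, (∑ l, R i l < 1) ∨ ∃ j, Reach R i j ∧ ∑ l, R j l < 1)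

/-- Stability condition: `c̄_i − Σ_j R j i * c̄_j > λ̄_i` for every link `i`, where bars
denote averages over one period `[0, T]`. -/
def Stability [Fintype E] (T : ℝ) (R : E → E → ℝ) (lam c : ℝ → E → ℝ) : Prop :=
  ∀ i : E, (1 / T) * ∫ s in (0:ℝ)..T, lam s i <
    (1 / T) * (∫ s in (0:ℝ)..T, c s i) -
      ∑ j, R j i * ((1 / T) * ∫ s in (0:ℝ)..T, c s j)

/-- A function that is piecewise constant on a compact interval is integrable on it. -/
theorem PwcOn.intervalIntegrable {f : ℝ → ℝ} {a b : ℝ} (hab : a ≤ b)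
    (hf : PwcOn f (Set.Icc a b)) : IntervalIntegrable f volume a b := by
  classical
  obtain ⟨D, hD⟩ := hf
  let n : ℝ → ℕ := fun u => (D.filter (· ≤ u)).card
  have hmono : Monotone n := fun u v huv =>
    Finset.card_le_card fun d hd => by
      simp only [Finset.mem_filter] at hd ⊢
      exact ⟨hd.1, hd.2.trans huv⟩
  have hconst : ∀ u ∈ Set.Icc a b, ∀ v ∈ Set.Icc a b, u ≤ v → n u = n v → f u = f v := by
    intro u hu v hv huv hn
    refine hD u hu v hv huv fun d hd hduv => ?_
    have hsub : D.filter (· ≤ u) ⊆ D.filter (· ≤ v) := fun e he => by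
      simp only [Finset.mem_filter] at he ⊢
      exact ⟨he.1, he.2.trans huv⟩
    have heq := Finset.eq_of_subset_of_card_le hsub hn.ge
    have : d ∈ D.filter (· ≤ u) := by
      rw [heq]
      simp [hd, hduv.2]
    simp only [Finset.mem_filter] at this
    exact absurd this.2 (not_le.mpr hduv.1)
  have hex : ∀ k : ℕ, ∃ r : ℝ, ∀ u ∈ Set.Icc a b, n u = k → f u = r := by
    intro k
    by_cases hk : ∃ u ∈ Set.Icc a b, n u = k
    · obtain ⟨u, hu, rfl⟩ := hk
      refine ⟨f u, fun v hv hvu => ?_⟩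
      rcases le_total u v with h | h
      · exact (hconst u hu v hv h hvu.symm).symm
      · exact hconst v hv u hu h hvu
    · exact ⟨0, fun u hu hn => absurd ⟨u, hu, hn⟩ hk⟩
  choose F hF using hex
  have hmeas : Measurable (F ∘ n) := (measurable_from_nat).comp hmono.measurable
  have hbd : ∀ u, ‖(F ∘ n) u‖ ≤ ∑ k ∈ Finset.range (D.card + 1), |F k| := by
    intro u
    refine Finset.single_le_sum (f := fun k => |F k|) (fun _ _ => abs_nonneg _) ?_
    exact Finset.mem_range.mpr (Nat.lt_succ_of_le (Finset.card_filter_le _ _))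
  rw [intervalIntegrable_iff_integrableOn_Icc_of_le hab]
  refine IntegrableOn.congr_fun (f := F ∘ n) ?_ (fun u hu => (hF _ u hu rfl).symm)
    measurableSet_Icc
  exact Measure.integrableOn_of_bounded (by simp) hmeas.aestronglyMeasurable
    (Filter.Eventually.of_forall hbd)

theorem LocPwcOn.intervalIntegrable {f : ℝ → ℝ} (hf : LocPwcOn f (Set.Ici 0)) {a b : ℝ}
    (ha : 0 ≤ a) (hb : 0 ≤ b) : IntervalIntegrable f volume a b := by
  wlog hab : a ≤ b
  · exact (this hf hb ha (le_of_not_ge hab)).symm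
  refine PwcOn.intervalIntegrable hab ?_
  have h := hf a b
  rwa [Set.inter_eq_right.mpr] at h
  exact fun u hu => ha.trans hu.1

theorem integral_add_nat_mul_period {f : ℝ → ℝ} {T : ℝ} (hT : 0 ≤ T)
    (hf : ∀ a b, 0 ≤ a → 0 ≤ b → IntervalIntegrable f volume a b)
    (hper : ∀ t, 0 ≤ t → f (t + T) = f t) {a : ℝ} (ha : 0 ≤ a) {n : ℕ} :
    ∫ s in a..a + n * T, f s = n * ∫ s in (0 : ℝ)..T, f s := by
  have hone : ∀ b, 0 ≤ b → ∫ s in b..b + T, f s = ∫ s in (0 : ℝ)..T, f s := by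
    intro b hb
    have h1 : ∫ s in T..b + T, f s = ∫ s in (0 : ℝ)..b, f s := by
      have h := intervalIntegral.integral_comp_add_right (a := 0) (b := b) f T
      rw [zero_add] at h
      rw [← h]
      refine intervalIntegral.integral_congr fun s hs => hper s ?_
      rw [Set.uIcc_of_le hb] at hs
      exact hs.1
    have h2 := intervalIntegral.integral_add_adjacent_intervals (hf 0 b le_rfl hb)
      (hf b (b + T) hb (by linarith))
    have h3 := intervalIntegral.integral_add_adjacent_intervals (hf 0 T le_rfl hT)
      (hf T (b + T) hT (by linarith))
    linarith
  induction n with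
  | zero => simp
  | succ n ih =>
    have hn : 0 ≤ a + n * T := by positivity
    have h1 := intervalIntegral.integral_add_adjacent_intervals (hf a (a + n * T) ha hn)
      (hf (a + n * T) (a + n * T + T) hn (by linarith))
    rw [ih, hone _ hn] at h1
    push_cast
    rw [show a + (n + 1) * T = a + n * T + T by ring, ← h1]
    ring

/-- If `Y` is a primitive of `h` and `g` dominates the derivative of `|Y|`, where it suffices that
`0 ≤ g` on the zero set of `Y`, then `|Y|` grows by at most the integral of `g`. -/
theorem abs_primitive_le_add_integral {h g Y : ℝ → ℝ} {a b : ℝ} (hab : a ≤ b)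
    (hh : IntervalIntegrable h volume a b) (hg : IntervalIntegrable g volume a b)
    (hY : ∀ t ∈ Set.Icc a b, Y t = Y a + ∫ s in a..t, h s)
    (hpos : ∀ t ∈ Set.Icc a b, 0 < Y t → h t ≤ g t)
    (hneg : ∀ t ∈ Set.Icc a b, Y t < 0 → -h t ≤ g t)
    (hzero : ∀ t ∈ Set.Icc a b, Y t = 0 → 0 ≤ g t) :
    |Y b| ≤ |Y a| + ∫ s in a..b, g s := by
  let F : ℝ → ℝ := fun t => Y a + ∫ s in a..t, h s
  have hac : AbsolutelyContinuousOnInterval F a b := by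
    have h1 : AbsolutelyContinuousOnInterval (fun _ : ℝ => Y a) a b :=
      ((LipschitzWith.const (Y a)).lipschitzOnWith).absolutelyContinuousOnInterval
    exact h1.add (hh.absolutelyContinuousOnInterval_intervalIntegral Set.left_mem_uIcc)
  have habs : AbsolutelyContinuousOnInterval (fun t => |F t|) a b := by
    rw [absolutelyContinuousOnInterval_iff] at hac ⊢
    intro ε hε
    obtain ⟨η, hη, H⟩ := hac ε hε
    refine ⟨η, hη, fun P hP hlt => lt_of_le_of_lt (Finset.sum_le_sum fun k _ => ?_) (H P hP hlt)⟩
    simpa only [Real.dist_eq] using abs_abs_sub_abs_le_abs_sub _ _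
  have hFY : ∀ t ∈ Set.Icc a b, F t = Y t := fun t ht => (hY t ht).symm
  have hle : ∫ s in a..b, deriv (fun t => |F t|) s ≤ ∫ s in a..b, g s := by
    refine intervalIntegral.integral_mono_ae_restrict hab habs.intervalIntegrable_deriv hg ?_
    rw [Filter.EventuallyLE, ae_restrict_iff' measurableSet_Icc]
    filter_upwards [hh.ae_hasDerivAt_integral] with s hs hsab
    have hd : HasDerivAt F (h s) s :=
      (hs (by rwa [Set.uIcc_of_le hab]) a Set.left_mem_uIcc).const_add _
    rcases lt_trichotomy (Y s) 0 with hY0 | hY0 | hY0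
    · have hF0 : F s < 0 := by rwa [hFY s hsab]
      have : HasDerivAt (fun t => |F t|) (-h s) s := by
        refine hd.neg.congr_of_eventuallyEq ?_
        filter_upwards [hd.continuousAt.eventually_lt_const hF0] with u hu
        exact abs_of_neg hu
      rw [this.deriv]
      exact hneg s hsab hY0
    · have hmin : IsLocalMin (fun t => |F t|) s := Filter.Eventually.of_forall fun u => by
        simp [hFY s hsab, hY0]
      rw [hmin.deriv_eq_zero]
      exact hzero s hsab hY0
    · have hF0 : 0 < F s := by rwa [hFY s hsab]
      have : HasDerivAt (fun t => |F t|) (h s) s := by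
        refine hd.congr_of_eventuallyEq ?_
        filter_upwards [hd.continuousAt.eventually_const_lt hF0] with u hu
        exact abs_of_pos hu
      rw [this.deriv]
      exact hpos s hsab hY0
  rw [habs.integral_deriv_eq_sub, hFY b ⟨hab, le_rfl⟩, hFY a ⟨le_rfl, hab⟩] at hle
  linarith

/-- Nonnegative vectors satisfying `G i ≤ C + Σ_j R j i * G j` are uniformly bounded when `R` is
substochastic and every link reaches one with row sum less than one. -/
theorem exists_bound_of_le_add_sum [Fintype E] {R : E → E → ℝ} (hR : ∀ j i, 0 ≤ R j i)
    (hrow : ∀ i, ∑ l, R i l ≤ 1)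
    (hleak : ∀ i : E, (∑ l, R i l < 1) ∨ ∃ j, Reach R i j ∧ ∑ l, R j l < 1)
    {ι : Type*} (G : ι → E → ℝ) (hG : ∀ t i, 0 ≤ G t i) (C : E → ℝ)
    (hGC : ∀ t i, G t i ≤ C i + ∑ j, R j i * G t j) (i : E) : ∃ B, ∀ t, G t i ≤ B := by
  have hswap : ∀ t, ∑ i, ∑ j, R j i * G t j = ∑ j, (∑ l, R j l) * G t j := fun t => by
    rw [Finset.sum_comm]
    simp only [Finset.sum_mul]
  have hdef : ∀ t j, 0 ≤ (1 - ∑ l, R j l) * G t j := fun t j =>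
    mul_nonneg (sub_nonneg.mpr (hrow j)) (hG t j)
  have hslack : ∀ t i, 0 ≤ C i + ∑ j, R j i * G t j - G t i := fun t i =>
    sub_nonneg.mpr (hGC t i)
  have htot : ∀ t, ∑ i, (C i + ∑ j, R j i * G t j - G t i)
      + ∑ j, (1 - ∑ l, R j l) * G t j = ∑ i, C i := fun t => by
    simp only [Finset.sum_sub_distrib, Finset.sum_add_distrib, sub_mul, one_mul, hswap]
    ring
  have hbase : ∀ j, ∑ l, R j l < 1 → ∃ B, ∀ t, G t j ≤ B := by
    intro j hj
    refine ⟨(∑ i, C i) / (1 - ∑ l, R j l), fun t => ?_⟩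
    rw [le_div_iff₀ (sub_pos.mpr hj), mul_comm]
    have h1 := Finset.single_le_sum (fun k _ => hdef t k) (Finset.mem_univ j)
    have h2 := Finset.sum_nonneg fun i (_ : i ∈ Finset.univ) => hslack t i
    have h3 := htot t
    linarith
  have hstep : ∀ j k, 0 < R j k → (∃ B, ∀ t, G t k ≤ B) → ∃ B, ∀ t, G t j ≤ B := by
    rintro j k hjk ⟨B, hB⟩
    refine ⟨(B + ∑ i, C i - C k) / R j k, fun t => ?_⟩
    rw [le_div_iff₀ hjk, mul_comm]
    have h1 := Finset.single_le_sum (fun k _ => hslack t k) (Finset.mem_univ k)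
    have h2 := Finset.sum_nonneg fun i (_ : i ∈ Finset.univ) => hdef t i
    have h3 := htot t
    have h4 := Finset.single_le_sum (f := fun j => R j k * G t j)
      (fun l _ => mul_nonneg (hR l k) (hG t l)) (Finset.mem_univ j)
    have h5 := hB t
    linarith
  rcases hleak i with hi | ⟨j, hij, hj⟩
  · exact hbase i hi
  · induction hij using Relation.TransGen.head_induction_on with
    | single h => exact hstep _ _ h (hbase j hj)
    | head h _ ih => exact hstep _ _ h ih

theorem dbar_nonneg (R δ : E → E → ℝ) : 0 ≤ dbar R δ := by
  refine Real.sSup_nonneg' ⟨0, Set.mem_insert _ _, le_rfl⟩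

theorem le_dbar [Finite E] {R δ : E → E → ℝ} {j i : E} (h : 0 < R j i) : δ j i ≤ dbar R δ := by
  refine le_csSup ?_ (Set.mem_insert_of_mem _ ⟨j, i, h, rfl⟩)
  refine Set.Finite.bddAbove (Set.Finite.insert _ ?_)
  refine (Set.finite_range fun p : E × E => δ p.1 p.2).subset ?_
  rintro _ ⟨j, i, -, rfl⟩
  exact ⟨(j, i), rfl⟩

section Solution

variable [Fintype E] {R δ : E → E → ℝ} {lam c x z xt zt : ℝ → E → ℝ}

/-- Every admissible value for the outflow of a single link, the other outflows being unchanged, is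
at most the actual outflow. -/
theorem IsSolution.le_outflow (hR : ∀ j i, 0 ≤ R j i) (hsol : IsSolution R δ lam c x z) {t : ℝ}
    (ht : 0 ≤ t) {i : E} {a : ℝ} (hac : a ≤ c t i)
    (hain : x t i = 0 → a ≤ lam t i + ∑ j, R j i * z (t - δ j i) j) : a ≤ z t i := by
  classical
  obtain ⟨-, -, -, hfeas, hmax, -⟩ := hsol
  by_contra! hlt
  let w : E → ℝ := Function.update (fun k => z t k) i a
  have hwi : w i = a := Function.update_self ..
  have hwk : ∀ k, k ≠ i → w k = z t k := fun k hk => Function.update_of_ne hk ..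
  have hzw : ∀ k, z t k ≤ w k := fun k => by
    rcases eq_or_ne k i with rfl | hk
    · rw [hwi]
      exact hlt.le
    · rw [hwk k hk]
  have hin : ∀ k, ∑ j, R j k * (if δ j k = 0 then z t j else z (t - δ j k) j)
      ≤ ∑ j, R j k * (if δ j k = 0 then w j else z (t - δ j k) j) := fun k =>
    Finset.sum_le_sum fun j _ => mul_le_mul_of_nonneg_left
      (by split_ifs; exacts [hzw j, le_rfl]) (hR j k)
  have hw : FeasibleAt R δ lam c x z t w := by
    refine ⟨fun k => ?_, fun k hk => ?_⟩
    · rcases eq_or_ne k i with rfl | hki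
      · rwa [hwi]
      · rw [hwk k hki]
        exact (hfeas t ht).1 k
    · rcases eq_or_ne k i with rfl | hki
      · rw [hwi]
        refine (hain hk).trans ((add_le_add_iff_left _).mpr (le_trans (le_of_eq ?_) (hin k)))
        refine Finset.sum_congr rfl fun j _ => ?_
        split_ifs with h
        · rw [h, sub_zero]
        · rfl
      · rw [hwk k hki]
        exact ((hfeas t ht).2 k hk).trans ((add_le_add_iff_left _).mpr (hin k))
  have hsum := hmax t ht w hw
  have : ∑ k, z t k < ∑ k, w k :=
    Finset.sum_lt_sum (fun k _ => hzw k) ⟨i, Finset.mem_univ i, by rwa [hwi]⟩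
  linarith

theorem IsSolution.outflow_le_capacity (hsol : IsSolution R δ lam c x z) {t : ℝ} (ht : 0 ≤ t)
    (i : E) : z t i ≤ c t i :=
  (hsol.2.2.2.1 t ht).1 i

theorem IsSolution.outflow_eq_capacity (hR : ∀ j i, 0 ≤ R j i) (hsol : IsSolution R δ lam c x z)
    {t : ℝ} (ht : 0 ≤ t) {i : E} (hx : 0 < x t i) : z t i = c t i :=
  le_antisymm (hsol.outflow_le_capacity ht i)
    (hsol.le_outflow hR ht le_rfl fun h => absurd h hx.ne')

theorem IsSolution.outflow_eq_min (hR : ∀ j i, 0 ≤ R j i) (hsol : IsSolution R δ lam c x z)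
    {t : ℝ} (ht : 0 ≤ t) {i : E} (hx : x t i = 0) :
    z t i = min (c t i) (lam t i + ∑ j, R j i * z (t - δ j i) j) := by
  refine le_antisymm (le_min (hsol.outflow_le_capacity ht i) ?_)
    (hsol.le_outflow hR ht (min_le_left _ _) fun _ => min_le_right _ _)
  refine ((hsol.2.2.2.1 t ht).2 i hx).trans (le_of_eq ?_)
  refine congrArg _ (Finset.sum_congr rfl fun j _ => ?_)
  split_ifs with h
  · rw [h, sub_zero]
  · rfl

theorem IsSolution.intervalIntegrable (hsol : IsSolution R δ lam c x z) (i : E) {a b : ℝ}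
    (ha : -dbar R δ ≤ a) (hb : -dbar R δ ≤ b) :
    IntervalIntegrable (fun s => z s i) volume a b := by
  refine IntegrableOn.intervalIntegrable ?_
  refine (hsol.2.2.1 i).integrableOn_compact_subset (fun u hu => ?_) isCompact_uIcc
  exact (le_min ha hb).trans hu.1

/-- An integrable outflow remains integrable after routing. -/
theorem intervalIntegrable_routed (hR : ∀ j i, 0 ≤ R j i) {f : ℝ → ℝ} {j i : E}
    (hf : ∀ a b, -dbar R δ ≤ a → -dbar R δ ≤ b → IntervalIntegrable f volume a b) {a b : ℝ}
    (ha : 0 ≤ a) (hb : 0 ≤ b) :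
    IntervalIntegrable (fun s => R j i * f (s - δ j i)) volume a b := by
  rcases (hR j i).eq_or_lt with h | h
  · simp [← h]
  · have hd := le_dbar (δ := δ) h
    have h1 := (hf (a - δ j i) (b - δ j i) (by linarith) (by linarith)).comp_sub_right (δ j i)
    simp only [sub_add_cancel] at h1
    exact h1.const_mul _

/-- The total inflow routed into a link is integrable. -/
theorem intervalIntegrable_sum_routed (hR : ∀ j i, 0 ≤ R j i) {f : ℝ → E → ℝ}
    (hf : ∀ j a b, -dbar R δ ≤ a → -dbar R δ ≤ b →
      IntervalIntegrable (fun s => f s j) volume a b) (i : E) {a b : ℝ}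
    (ha : 0 ≤ a) (hb : 0 ≤ b) :
    IntervalIntegrable (fun s => ∑ j, R j i * f (s - δ j i) j) volume a b := by
  simpa only [Finset.sum_fn] using IntervalIntegrable.sum Finset.univ fun j _ =>
    intervalIntegrable_routed hR (hf j) (i := i) ha hb

theorem IsSolution.intervalIntegrable_sub (hsol : IsSolution R δ lam c x z)
    (hsolt : IsSolution R δ lam c xt zt) (i : E) {a b : ℝ} (ha : -dbar R δ ≤ a)
    (hb : -dbar R δ ≤ b) : IntervalIntegrable (fun s => z s i - zt s i) volume a b :=
  (hsol.intervalIntegrable i ha hb).sub (hsolt.intervalIntegrable i ha hb)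

theorem IsSolution.queue_eq_add_integral (hR : ∀ j i, 0 ≤ R j i)
    (hlam : ∀ i a b, 0 ≤ a → 0 ≤ b → IntervalIntegrable (fun s => lam s i) volume a b)
    (hsol : IsSolution R δ lam c x z) (i : E) {a t : ℝ} (ha : 0 ≤ a) (ht : 0 ≤ t) :
    x t i = x a i + ∫ s in a..t, (lam s i + ∑ j, R j i * z (s - δ j i) j - z s i) := by
  have hd := dbar_nonneg R δ
  have hint : ∀ b, 0 ≤ b → IntervalIntegrable
      (fun s => lam s i + ∑ j, R j i * z (s - δ j i) j - z s i) volume 0 b := fun b hb =>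
    ((hlam i 0 b le_rfl hb).add (intervalIntegrable_sum_routed hR
      (fun j _ _ => hsol.intervalIntegrable j) i le_rfl hb)).sub
      (hsol.intervalIntegrable i (by linarith) (by linarith))
  rw [hsol.2.2.2.2.2 t ht i, hsol.2.2.2.2.2 a ha i,
    ← intervalIntegral.integral_interval_sub_left (hint t ht) (hint a ha)]
  ring

theorem IsSolution.queue_sub_eq (hR : ∀ j i, 0 ≤ R j i)
    (hlam : ∀ i a b, 0 ≤ a → 0 ≤ b → IntervalIntegrable (fun s => lam s i) volume a b)
    (hsol : IsSolution R δ lam c x z) (hsolt : IsSolution R δ lam c xt zt) (i : E) {t : ℝ}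
    (ht : 0 ≤ t) :
    x t i - xt t i = x 0 i - xt 0 i + ∫ s in (0 : ℝ)..t,
      (∑ j, R j i * (z (s - δ j i) j - zt (s - δ j i) j) - (z s i - zt s i)) := by
  have hd := dbar_nonneg R δ
  have hint : ∀ {x z : ℝ → E → ℝ}, IsSolution R δ lam c x z → IntervalIntegrable
      (fun s => lam s i + ∑ j, R j i * z (s - δ j i) j - z s i) volume 0 t := fun {x z} hs =>
    ((hlam i 0 t le_rfl ht).add (intervalIntegrable_sum_routed hR
      (fun j _ _ => hs.intervalIntegrable j) i le_rfl ht)).sub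
      (hs.intervalIntegrable i (by linarith) (by linarith))
  rw [hsol.2.2.2.2.2 t ht i, hsolt.2.2.2.2.2 t ht i, add_sub_add_comm,
    ← intervalIntegral.integral_sub (hint hsol) (hint hsolt)]
  congr 2
  ext s
  simp only [mul_sub, Finset.sum_sub_distrib]
  ring

/-- The distance of two queues grows at most by the difference of what is routed into them minus
the difference of what leaves them. -/
theorem IsSolution.abs_queue_sub_le (hR : ∀ j i, 0 ≤ R j i)
    (hlam : ∀ i a b, 0 ≤ a → 0 ≤ b → IntervalIntegrable (fun s => lam s i) volume a b)
    (hsol : IsSolution R δ lam c x z) (hsolt : IsSolution R δ lam c xt zt) (i : E) {t : ℝ}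
    (ht : 0 ≤ t) :
    |x t i - xt t i| ≤ |x 0 i - xt 0 i| + ∫ s in (0 : ℝ)..t,
      (∑ j, R j i * |z (s - δ j i) j - zt (s - δ j i) j| - |z s i - zt s i|) := by
  have hd := dbar_nonneg R δ
  have hD := fun j a b => hsol.intervalIntegrable_sub hsolt j (a := a) (b := b)
  have htri : ∀ s, |∑ j, R j i * (z (s - δ j i) j - zt (s - δ j i) j)|
      ≤ ∑ j, R j i * |z (s - δ j i) j - zt (s - δ j i) j| := fun s => by
    refine (Finset.abs_sum_le_sum_abs _ _).trans (le_of_eq (Finset.sum_congr rfl fun j _ => ?_))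
    rw [abs_mul, abs_of_nonneg (hR j i)]
  refine abs_primitive_le_add_integral (Y := fun t => x t i - xt t i) ht
    ((intervalIntegrable_sum_routed (f := fun s j => z s j - zt s j) hR hD i le_rfl ht).sub
      (hD i _ _ (by linarith) (by linarith)))
    ((intervalIntegrable_sum_routed (f := fun s j => |z s j - zt s j|) hR
      (fun j a b ha hb => (hD j a b ha hb).abs) i le_rfl ht).sub
      (hD i _ _ (by linarith) (by linarith)).abs)
    (fun s hs => hsol.queue_sub_eq hR hlam hsolt i hs.1) ?_ ?_ ?_
  all_goals
    intro s hs hY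
    have h1 := htri s
  · have hx : 0 < x s i := by linarith [hsolt.1 s hs.1 i]
    have hz := hsol.outflow_eq_capacity hR hs.1 hx
    have hzt := hsolt.outflow_le_capacity hs.1 i
    rw [abs_of_nonneg (a := z s i - zt s i) (by linarith)]
    linarith [le_abs_self (∑ j, R j i * (z (s - δ j i) j - zt (s - δ j i) j))]
  · have hx : 0 < xt s i := by linarith [hsol.1 s hs.1 i]
    have hz := hsolt.outflow_eq_capacity hR hs.1 hx
    have hzt := hsol.outflow_le_capacity hs.1 i
    rw [abs_of_nonpos (a := z s i - zt s i) (by linarith)]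
    linarith [neg_abs_le (∑ j, R j i * (z (s - δ j i) j - zt (s - δ j i) j))]
  · have hxx : x s i = xt s i := sub_eq_zero.mp hY
    rcases (hsol.1 s hs.1 i).eq_or_lt with h0 | hx
    · rw [hsol.outflow_eq_min hR hs.1 h0.symm,
        hsolt.outflow_eq_min hR hs.1 (hxx ▸ h0.symm)]
      have h2 := abs_min_sub_min_le_max (c s i) (lam s i + ∑ j, R j i * z (s - δ j i) j)
        (c s i) (lam s i + ∑ j, R j i * zt (s - δ j i) j)
      rw [sub_self, abs_zero, max_eq_right (abs_nonneg _), add_sub_add_left_eq_sub,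
        ← Finset.sum_sub_distrib] at h2
      simp only [mul_sub] at h1
      linarith
    · rw [hsol.outflow_eq_capacity hR hs.1 hx, hsolt.outflow_eq_capacity hR hs.1 (hxx ▸ hx),
        sub_self, abs_zero, sub_zero]
      exact (abs_nonneg _).trans h1

/-- The difference of the outflows of two solutions is integrable. -/
theorem IsSolution.integrableOn_outflow_sub (hR : ∀ j i, 0 ≤ R j i) (hδ : ∀ j i, 0 ≤ δ j i)
    (hconn : ConnAssumption R)
    (hlam : ∀ i a b, 0 ≤ a → 0 ≤ b → IntervalIntegrable (fun s => lam s i) volume a b)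
    (hsol : IsSolution R δ lam c x z) (hsolt : IsSolution R δ lam c xt zt) (i : E) :
    IntegrableOn (fun s => z s i - zt s i) (Set.Ioi (-dbar R δ)) := by
  have hd := dbar_nonneg R δ
  have hD := fun j a b => hsol.intervalIntegrable_sub hsolt j (a := a) (b := b)
  let G : ℕ → E → ℝ := fun n j => ∫ s in (-dbar R δ)..n, |z s j - zt s j|
  have hle : ∀ n : ℕ, -dbar R δ ≤ n := fun n => by linarith [n.cast_nonneg (α := ℝ)]
  have hrouted : ∀ (n : ℕ) j i,
      ∫ s in (0 : ℝ)..n, R j i * |z (s - δ j i) j - zt (s - δ j i) j| ≤ R j i * G n j := by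
    intro n j i
    rcases (hR j i).eq_or_lt with h | h
    · simp [← h]
    · have h1 := le_dbar (δ := δ) h
      rw [intervalIntegral.integral_const_mul,
        intervalIntegral.integral_comp_sub_right (fun s => |z s j - zt s j|)]
      refine mul_le_mul_of_nonneg_left ?_ h.le
      refine intervalIntegral.integral_mono_interval (by linarith)
        (by linarith [n.cast_nonneg (α := ℝ)]) (by linarith [hδ j i])
        (Filter.Eventually.of_forall fun _ => abs_nonneg _)
        (hD j _ _ le_rfl (hle n)).abs
  have hG : ∀ n j, G n j ≤ (∫ s in (-dbar R δ)..0, |z s j - zt s j|) + |x 0 j - xt 0 j|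
      + ∑ k, R k j * G n k := by
    intro n j
    have hn : (0 : ℝ) ≤ n := n.cast_nonneg
    have hI : ∀ k ∈ Finset.univ, IntervalIntegrable
        (fun s => R k j * |z (s - δ k j) k - zt (s - δ k j) k|) volume 0 n := fun k _ =>
      intervalIntegrable_routed (f := fun s => |z s k - zt s k|) hR
        (fun a b ha hb => (hD k a b ha hb).abs) le_rfl hn
    have h1 := hsol.abs_queue_sub_le hR hlam hsolt j hn
    have h2 : (∫ s in (-dbar R δ)..0, |z s j - zt s j|) + (∫ s in (0 : ℝ)..n, |z s j - zt s j|)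
        = G n j := intervalIntegral.integral_add_adjacent_intervals
      (hD j _ _ le_rfl (by linarith)).abs (hD j _ _ (by linarith) (hle n)).abs
    rw [intervalIntegral.integral_sub
      (by simpa only [Finset.sum_fn] using IntervalIntegrable.sum Finset.univ hI)
      (hD j _ _ (by linarith) (hle n)).abs, intervalIntegral.integral_finsetSum hI] at h1
    have h3 := Finset.sum_le_sum fun k (_ : k ∈ Finset.univ) => hrouted n k j
    linarith [abs_nonneg (x n j - xt n j)]
  obtain ⟨B, hB⟩ := exists_bound_of_le_add_sum hR hconn.2.1 hconn.2.2 G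
    (fun n j => intervalIntegral.integral_nonneg (hle n) fun _ _ => abs_nonneg _) _ hG i
  refine integrableOn_Ioi_of_intervalIntegral_norm_bounded B _
    (fun n => ((intervalIntegrable_iff_integrableOn_Ioc_of_le (hle n)).mp
      (hD i _ _ le_rfl (hle n)))) tendsto_natCast_atTop_atTop
    (Filter.Eventually.of_forall hB)

/-- Under the stability condition no queue stays above the one of another solution forever. -/
theorem IsSolution.not_forall_queue_lt {T : ℝ} (hT : 0 < T) (hR : ∀ j i, 0 ≤ R j i)
    (hlam : ∀ i a b, 0 ≤ a → 0 ≤ b → IntervalIntegrable (fun s => lam s i) volume a b)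
    (hc : ∀ i a b, 0 ≤ a → 0 ≤ b → IntervalIntegrable (fun s => c s i) volume a b)
    (hlam_per : ∀ t, 0 ≤ t → ∀ i, lam (t + T) i = lam t i)
    (hc_per : ∀ t, 0 ≤ t → ∀ i, c (t + T) i = c t i)
    (hstab : Stability T R lam c)
    (hsol : IsSolution R δ lam c x z) (hsolt : IsSolution R δ lam c xt zt) {i : E}
    (hint : IntegrableOn (fun s => z s i - zt s i) (Set.Ioi (-dbar R δ))) (t₀ : ℝ) :
    ¬ ∀ t, t₀ ≤ t → xt t i < x t i := by
  intro hlt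
  have hd := dbar_nonneg R δ
  let K := max t₀ (dbar R δ)
  have hKd : dbar R δ ≤ K := le_max_right _ _
  have hK0 : 0 ≤ K := hd.trans hKd
  let η := (∫ s in (0 : ℝ)..T, c s i) - ∑ j, R j i * (∫ s in (0 : ℝ)..T, c s j)
    - ∫ s in (0 : ℝ)..T, lam s i
  have hη : 0 < η := by
    have h := hstab i
    simp only [mul_left_comm _ (1 / T), ← Finset.mul_sum, ← mul_sub] at h
    have := lt_of_mul_lt_mul_left h (by positivity)
    simp only [η]
    linarith
  let B := ∫ s in Set.Ioi (-dbar R δ), |z s i - zt s i|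
  obtain ⟨n, hn⟩ := exists_nat_gt ((xt K i + B) / η)
  rw [div_lt_iff₀ hη] at hn
  let t := K + n * T
  have hKt : K ≤ t := le_add_of_nonneg_right (by positivity)
  have ht0 : 0 ≤ t := hK0.trans hKt
  have hDI := hsol.intervalIntegrable_sub hsolt i (a := K) (b := t) (by linarith) (by linarith)
  have hcI : ∀ j ∈ Finset.univ, IntervalIntegrable (fun s => R j i * c (s - δ j i) j)
      volume K t := by
    intro j _
    rcases (hR j i).eq_or_lt with h | h
    · simp [← h]
    · have h1 := le_dbar (δ := δ) h
      have h2 := (hc j (K - δ j i) (t - δ j i) (by linarith) (by linarith)).comp_sub_right (δ j i)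
      simp only [sub_add_cancel] at h2
      exact h2.const_mul _
  have hsumI : IntervalIntegrable (fun s => ∑ j, R j i * c (s - δ j i) j) volume K t := by
    simpa only [Finset.sum_fn] using IntervalIntegrable.sum Finset.univ hcI
  have hcint : ∀ j, ∫ s in K..t, R j i * c (s - δ j i) j
      = n * (R j i * ∫ s in (0 : ℝ)..T, c s j) := by
    intro j
    rcases (hR j i).eq_or_lt with h | h
    · simp [← h]
    · have h1 := le_dbar (δ := δ) h
      rw [intervalIntegral.integral_const_mul,
        intervalIntegral.integral_comp_sub_right (fun s => c s j),
        show t - δ j i = (K - δ j i) + n * T by simp only [t]; ring,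
        integral_add_nat_mul_period hT.le (hc j) (fun t ht => hc_per t ht j) (by linarith)]
      ring
  have hmono : ∫ s in K..t, (lam s i + ∑ j, R j i * zt (s - δ j i) j - zt s i)
      ≤ ∫ s in K..t, (lam s i + ∑ j, R j i * c (s - δ j i) j - c s i + (z s i - zt s i)) := by
    refine intervalIntegral.integral_mono_on hKt ?_ ?_ fun s hs => ?_
    · exact ((hlam i K t hK0 ht0).add (intervalIntegrable_sum_routed hR
        (fun j _ _ => hsolt.intervalIntegrable j) i hK0 ht0)).sub
        (hsolt.intervalIntegrable i (by linarith) (by linarith))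
    · exact (((hlam i K t hK0 ht0).add hsumI).sub (hc i K t hK0 ht0)).add hDI
    · have hs0 : 0 ≤ s := hK0.trans hs.1
      have hx : 0 < x s i :=
        (hsolt.1 s hs0 i).trans_lt (hlt s ((le_max_left _ _).trans hs.1))
      rw [hsol.outflow_eq_capacity hR hs0 hx]
      have : ∑ j, R j i * zt (s - δ j i) j ≤ ∑ j, R j i * c (s - δ j i) j := by
        refine Finset.sum_le_sum fun j _ => ?_
        rcases (hR j i).eq_or_lt with h | h
        · simp [← h]
        · have h1 := le_dbar (δ := δ) h
          exact mul_le_mul_of_nonneg_left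
            (hsolt.outflow_le_capacity (by linarith [hs.1]) j) h.le
      linarith
  have hDB : ∫ s in K..t, (z s i - zt s i) ≤ B := by
    refine (intervalIntegral.integral_mono_on hKt hDI hDI.abs fun s _ => le_abs_self _).trans ?_
    rw [intervalIntegral.integral_of_le hKt]
    refine setIntegral_mono_set hint.abs (Filter.Eventually.of_forall fun _ => abs_nonneg _) ?_
    exact Filter.Eventually.of_forall fun s hs => lt_of_le_of_lt (by linarith) hs.1
  have hq := hsolt.queue_eq_add_integral hR hlam i hK0 ht0
  rw [intervalIntegral.integral_add
      (((hlam i K t hK0 ht0).add hsumI).sub (hc i K t hK0 ht0)) hDI,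
    intervalIntegral.integral_sub ((hlam i K t hK0 ht0).add hsumI) (hc i K t hK0 ht0),
    intervalIntegral.integral_add (hlam i K t hK0 ht0) hsumI,
    intervalIntegral.integral_finsetSum hcI, Finset.sum_congr rfl fun j _ => hcint j,
    ← Finset.mul_sum,
    integral_add_nat_mul_period hT.le (hlam i) (fun t ht => hlam_per t ht i) hK0,
    integral_add_nat_mul_period hT.le (hc i) (fun t ht => hc_per t ht i) hK0] at hmono
  have hη' : n * η = n * (∫ s in (0 : ℝ)..T, c s i)
      - n * (∑ j, R j i * (∫ s in (0 : ℝ)..T, c s j)) - n * ∫ s in (0 : ℝ)..T, lam s i := by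
    simp only [η]
    ring
  linarith [hsolt.1 t ht0 i]

end Solution

/-- Global attractivity: under the connectivity assumption, `T`-periodic locally
piecewise constant `λ` and `c`, and the stability condition, any two solutions of the
traffic flow model with piecewise constant initial histories approach each other in the
ℓ¹ sense, both in queue lengths and in in-transit vehicles. -/
theorem traffic_flow_convergence [Fintype E] [Nonempty E]
    (R δ : E → E → ℝ) (lam c : ℝ → E → ℝ) (x z xt zt : ℝ → E → ℝ) (T : ℝ)
    (hT : 0 < T) (hRnn : ∀ j i, 0 ≤ R j i) (hδnn : ∀ j i, 0 ≤ δ j i)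
    (hconn : ConnAssumption R)
    (hlam_nn : ∀ t, 0 ≤ t → ∀ i, 0 ≤ lam t i)
    (hc_nn : ∀ t, 0 ≤ t → ∀ i, 0 ≤ c t i)
    (hlam_pwc : ∀ i, LocPwcOn (fun t => lam t i) (Set.Ici 0))
    (hc_pwc : ∀ i, LocPwcOn (fun t => c t i) (Set.Ici 0))
    (hlam_per : ∀ t, 0 ≤ t → ∀ i, lam (t + T) i = lam t i)
    (hc_per : ∀ t, 0 ≤ t → ∀ i, c (t + T) i = c t i)
    (hstab : Stability T R lam c)
    (hsol : IsSolution R δ lam c x z) (hsolt : IsSolution R δ lam c xt zt)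
    (hz_hist_pwc : ∀ i, PwcOn (fun t => z t i) (Set.Ico (-(dbar R δ)) 0))
    (hzt_hist_pwc : ∀ i, PwcOn (fun t => zt t i) (Set.Ico (-(dbar R δ)) 0)) :
    Filter.Tendsto (fun t => ∑ i, |x t i - xt t i|) Filter.atTop (nhds 0) ∧
    Filter.Tendsto
      (fun t => ∑ i, ∑ j, R j i * ∫ s in (t - δ j i)..t, |z s j - zt s j|)
      Filter.atTop (nhds 0) := by
  have hlam := fun i a b => (hlam_pwc i).intervalIntegrable (a := a) (b := b)
  have hc := fun i a b => (hc_pwc i).intervalIntegrable (a := a) (b := b)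
  have hd := dbar_nonneg R δ
  have hint := hsol.integrableOn_outflow_sub hRnn hδnn hconn hlam hsolt
  have hint' := hsolt.integrableOn_outflow_sub hRnn hδnn hconn hlam hsol
  constructor
  · rw [← Finset.sum_const_zero (s := (Finset.univ : Finset E))]
    refine tendsto_finsetSum _ fun i _ => ?_
    have hrouted : IntegrableOn
        (fun s => ∑ j, R j i * (z (s - δ j i) j - zt (s - δ j i) j) - (z s i - zt s i))
        (Set.Ioi 0) := by
      refine Integrable.sub (integrable_finsetSum _ fun j _ => ?_)
        ((hint i).mono_set (Set.Ioi_subset_Ioi (by linarith)))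
      rcases (hRnn j i).eq_or_lt with h | h
      · simp [← h]
      · have h1 := (MeasurePreserving.integrableOn_comp_preimage
          (measurePreserving_sub_right volume (δ j i))
          (measurableEmbedding_subRight (δ j i))).mpr (hint j)
        refine Integrable.const_mul (h1.mono_set fun s hs => ?_) _
        have h2 := le_dbar (δ := δ) h
        simp only [Set.mem_preimage, Set.mem_Ioi] at hs ⊢
        linarith
    obtain ⟨L, hL⟩ : ∃ L, Filter.Tendsto (fun t => x t i - xt t i) Filter.atTop (nhds L) :=
      ⟨_, ((intervalIntegral_tendsto_integral_Ioi 0 hrouted Filter.tendsto_id).const_add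
        (x 0 i - xt 0 i)).congr' (by
          filter_upwards [Filter.eventually_ge_atTop 0] with t ht
          exact (hsol.queue_sub_eq hRnn hlam hsolt i ht).symm)⟩
    have hL0 : L = 0 := by
      rcases lt_trichotomy L 0 with h | h | h
      · obtain ⟨t₀, ht₀⟩ := Filter.eventually_atTop.mp (hL.eventually_lt_const h)
        exact absurd (fun t ht => sub_neg.mp (ht₀ t ht))
          (hsolt.not_forall_queue_lt hT hRnn hlam hc hlam_per hc_per hstab hsol (hint' i) t₀)
      · exact h
      · obtain ⟨t₀, ht₀⟩ := Filter.eventually_atTop.mp (hL.eventually_const_lt h)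
        exact absurd (fun t ht => sub_pos.mp (ht₀ t ht))
          (hsol.not_forall_queue_lt hT hRnn hlam hc hlam_per hc_per hstab hsolt (hint i) t₀)
    simpa [hL0] using hL.abs
  · rw [← Finset.sum_const_zero (s := (Finset.univ : Finset E))]
    refine tendsto_finsetSum _ fun i _ => ?_
    rw [← Finset.sum_const_zero (s := (Finset.univ : Finset E))]
    refine tendsto_finsetSum _ fun j _ => ?_
    have hD := fun a b => (hsol.intervalIntegrable_sub hsolt j (a := a) (b := b))
    have h1 := intervalIntegral_tendsto_integral_Ioi (-dbar R δ) (hint j).abs Filter.tendsto_id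
    have h2 := intervalIntegral_tendsto_integral_Ioi (-dbar R δ) (hint j).abs
      (Filter.tendsto_atTop_add_const_right _ (-δ j i) Filter.tendsto_id)
    have h3 := (h1.sub h2).const_mul (R j i)
    rw [sub_self, mul_zero] at h3
    refine h3.congr' ?_
    filter_upwards [Filter.eventually_ge_atTop (δ j i)] with t ht
    have hδt := hδnn j i
    simp only [id, ← sub_eq_add_neg]
    rw [intervalIntegral.integral_interval_sub_left
      (hD _ _ le_rfl (by linarith)).abs (hD _ _ le_rfl (by linarith)).abs]
end

section
/- Let x be a queue trajectory for (y, c). If x(α) = 0 for some α ≥ 0 and y(t) ≤ c(t) for almost every t ∈ [α, α + ε] (where ε > 0), then x(t) = 0 for every t ∈ [α, α + ε]. -/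
open MeasureTheory

/-- `f` is locally piecewise constant on `[0, ∞)`: piecewise constant on every compact
subinterval. -/
def LocPwc (f : ℝ → ℝ) : Prop :=
  ∀ a b : ℝ, PwcOn f (Set.Ici 0 ∩ Set.Icc a b)

/-- The net rate of change of the queue: `y − c` when the queue is positive, and
`max (y − c) 0` when the queue is empty. -/
noncomputable def qrate (y c x : ℝ → ℝ) (r : ℝ) : ℝ :=
  if 0 < x r then y r - c r else max (y r - c r) 0

/-- `x` is a queue trajectory for inflow `y` and capacity `c`: it is nonnegative on
`[0, ∞)` and satisfies `x t = x 0 + ∫_0^t qrate` for every `t ≥ 0`. -/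
def QueueTraj (y c x : ℝ → ℝ) : Prop :=
  (∀ t, 0 ≤ t → 0 ≤ x t) ∧
  ∀ t, 0 ≤ t → x t = x 0 + ∫ r in (0:ℝ)..t, qrate y c x r

/-- The outflow of the queue trajectory `x` for `(y, c)`: the capacity when the queue is
positive, and `min y c` when the queue is empty. -/
noncomputable def outflow (y c x : ℝ → ℝ) (t : ℝ) : ℝ :=
  if 0 < x t then c t else min (y t) (c t)

/-- `α` is a transition point of the queue trajectory `x`: `x α = 0` and `x` is strictly
positive on some interval `(α, α + ε]`. -/
def TransitionPt (x : ℝ → ℝ) (α : ℝ) : Prop :=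
  0 ≤ α ∧ x α = 0 ∧ ∃ ε > 0, ∀ t ∈ Set.Ioc α (α + ε), 0 < x t

/-- The primitive `t ↦ ∫ r in a..t, f r` of an arbitrary function is measurable: it is continuous
on the interval where the integral is defined, and zero elsewhere. -/
theorem measurable_intervalIntegral_right (f : ℝ → ℝ) (a : ℝ) :
    Measurable fun t => ∫ r in a..t, f r := by
  classical
  set S : Set ℝ := {t | IntervalIntegrable f volume a t}
  have hS : S.OrdConnected := by
    refine ⟨fun s hs t ht u hu => ?_⟩
    have hst : IntervalIntegrable f volume s t := hs.symm.trans ht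
    refine IntervalIntegrable.trans hs (hst.mono_set ?_)
    rw [Set.uIcc_of_le hu.1, Set.uIcc_of_le (hu.1.trans hu.2)]
    exact Set.Icc_subset_Icc_right hu.2
  have hcont : ContinuousOn (fun t => ∫ r in a..t, f r) S := by
    intro t ht
    have hl : ∃ b ∈ S, b ≤ t ∧ ∀ᶠ s in nhdsWithin t S, b ≤ s := by
      by_cases h : ∃ b ∈ S, b < t
      · obtain ⟨b, hb, hbt⟩ := h
        exact ⟨b, hb, hbt.le, nhdsWithin_le_nhds (eventually_ge_nhds hbt)⟩
      · push Not at h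
        exact ⟨t, ht, le_rfl, Filter.eventually_of_mem self_mem_nhdsWithin h⟩
    have hr : ∃ b ∈ S, t ≤ b ∧ ∀ᶠ s in nhdsWithin t S, s ≤ b := by
      by_cases h : ∃ b ∈ S, t < b
      · obtain ⟨b, hb, hbt⟩ := h
        exact ⟨b, hb, hbt.le, nhdsWithin_le_nhds (eventually_le_nhds hbt)⟩
      · push Not at h
        exact ⟨t, ht, le_rfl, Filter.eventually_of_mem self_mem_nhdsWithin h⟩
    obtain ⟨b₁, hb₁, -, hl⟩ := hl
    obtain ⟨b₂, hb₂, -, hr⟩ := hr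
    have ha : a ∈ S := IntervalIntegrable.refl
    have hmin : min a b₁ ∈ S := by rcases min_choice a b₁ with h | h <;> rwa [h]
    have hmax : max a b₂ ∈ S := by rcases max_choice a b₂ with h | h <;> rwa [h]
    refine (intervalIntegral.continuousWithinAt_primitive (by simp)
      (hmin.symm.trans hmax)).mono_of_mem_nhdsWithin ?_
    filter_upwards [hl, hr] with s h₁ h₂ using ⟨h₁, h₂⟩
  have heq : (fun t => ∫ r in a..t, f r) = S.piecewise (fun t => ∫ r in a..t, f r) 0 := by
    funext t
    by_cases ht : t ∈ S
    · simp [ht]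
    · simpa [ht] using intervalIntegral.integral_undef ht
  rw [heq]
  exact hcont.measurable_piecewise continuousOn_const hS.measurableSet

theorem abs_qrate_le (y c x : ℝ → ℝ) (r : ℝ) : |qrate y c x r| ≤ |y r - c r| := by
  unfold qrate
  split_ifs
  · exact le_rfl
  · rw [abs_of_nonneg (le_max_right _ _)]
    exact max_le (le_abs_self _) (abs_nonneg _)

theorem qrate_nonpos {y c x : ℝ → ℝ} {r : ℝ} (h : y r ≤ c r) : qrate y c x r ≤ 0 := by
  unfold qrate
  split_ifs
  · linarith
  · exact max_le (by linarith) le_rfl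

theorem QueueTraj.intervalIntegrable_qrate {y c x : ℝ → ℝ} (hx : QueueTraj y c x)
    (hy : LocallyIntegrableOn y (Set.Ici 0)) (hc : LocallyIntegrableOn c (Set.Ici 0))
    {t : ℝ} (ht : 0 ≤ t) : IntervalIntegrable (qrate y c x) volume 0 t := by
  rw [intervalIntegrable_iff_integrableOn_Icc_of_le ht]
  have hyc : IntegrableOn (fun r => y r - c r) (Set.Icc 0 t) :=
    (hy.integrableOn_compact_subset Set.Icc_subset_Ici_self isCompact_Icc).sub
      (hc.integrableOn_compact_subset Set.Icc_subset_Ici_self isCompact_Icc)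
  refine Integrable.mono hyc ?_ (ae_of_all _ (abs_qrate_le y c x))
  have hm : Measurable fun s => x 0 + ∫ r in (0:ℝ)..s, qrate y c x r :=
    (measurable_intervalIntegral_right _ _).const_add _
  have hpos : MeasurableSet {s | 0 < x 0 + ∫ r in (0:ℝ)..s, qrate y c x r} :=
    measurableSet_lt measurable_const hm
  have hmax : AEStronglyMeasurable (fun r => max (y r - c r) 0) (volume.restrict (Set.Icc 0 t)) :=
    (hyc.aemeasurable.max aemeasurable_const).aestronglyMeasurable
  classical
  refine (AEStronglyMeasurable.piecewise hpos hyc.aestronglyMeasurable.restrict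
    hmax.restrict).congr ?_
  filter_upwards [ae_restrict_mem measurableSet_Icc] with s hs
  simp only [Set.piecewise, Set.mem_setOf_eq, ← hx.2 s hs.1]
  rfl

/-- If the queue is empty at time `α` and the inflow does not exceed the capacity almost
everywhere on `[α, α + ε]`, then the queue stays empty on `[α, α + ε]`. -/
theorem queue_stays_zero (y c x : ℝ → ℝ) (α ε : ℝ)
    (hy_nn : ∀ t, 0 ≤ t → 0 ≤ y t) (hc_nn : ∀ t, 0 ≤ t → 0 ≤ c t)
    (hy_int : LocallyIntegrableOn y (Set.Ici 0))
    (hc_int : LocallyIntegrableOn c (Set.Ici 0))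
    (hx : QueueTraj y c x)
    (hα : 0 ≤ α) (hε : 0 < ε) (h0 : x α = 0)
    (hle : ∀ᵐ t ∂volume, t ∈ Set.Icc α (α + ε) → y t ≤ c t) :
    ∀ t ∈ Set.Icc α (α + ε), x t = 0 := by
  intro t ht
  have h0t : 0 ≤ t := hα.trans ht.1
  have hsub : x t - x α = ∫ r in α..t, qrate y c x r := by
    rw [hx.2 t h0t, hx.2 α hα, add_sub_add_left_eq_sub]
    exact intervalIntegral.integral_interval_sub_left
      (hx.intervalIntegrable_qrate hy_int hc_int h0t)
      (hx.intervalIntegrable_qrate hy_int hc_int hα)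
  have hnonpos : ∫ r in α..t, qrate y c x r ≤ 0 := by
    rw [intervalIntegral.integral_of_le ht.1]
    refine integral_nonpos_of_ae ?_
    filter_upwards [ae_restrict_of_ae hle, ae_restrict_mem measurableSet_Ioc] with r hr hmem
    exact qrate_nonpos (hr ⟨hmem.1.le, hmem.2.trans ht.2⟩)
  linarith [hx.1 t h0t]
end

section
/- Let y and c be locally piecewise constant, let x be a queue trajectory for (y, c), and let α > 0 be a transition point of x. Then: (i) there exists δ > 0 such that y(t) > c(t) for all t ∈ (α, α + δ); and (ii) for every ε ∈ (0, α] there exists t ∈ (α − ε, α) with y(t) ≤ c(t). In other words, every transition point of x is the left endpoint of a maximal interval on which the inflow strictly exceeds the capacity. -/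
open MeasureTheory

open Filter Topology in
/-- A locally piecewise constant function is constant on a right neighbourhood of each
point of `[0, ∞)`. -/
theorem LocPwc.exists_right_const {f : ℝ → ℝ} (hf : LocPwc f) {a : ℝ} (ha : 0 ≤ a) :
    ∃ b > a, ∀ t ∈ Set.Ico a b, f t = f a := by
  obtain ⟨D, hD⟩ := hf a (a + 1)
  have h : ∀ᶠ b in 𝓝[>] a, ∀ d ∈ D, a < d → b < d := by
    rw [Filter.eventually_all_finset]
    intro d _
    by_cases had : a < d
    · filter_upwards [Ioo_mem_nhdsGT had] with b hb _ using hb.2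
    · exact Eventually.of_forall fun _ h => absurd h had
  obtain ⟨b, hb, hab, hb1⟩ := (h.and (Ioo_mem_nhdsGT (lt_add_one a))).exists
  refine ⟨b, hab, fun t ht => (hD a ⟨ha, le_rfl, by linarith⟩ t
    ⟨ha.trans ht.1, ht.1, by linarith [ht.2]⟩ ht.1 fun d hd hdt => ?_).symm⟩
  linarith [hb d hd hdt.1, hdt.2, ht.2]

open Filter Topology in
/-- A locally piecewise constant function is constant on a left neighbourhood of each
point of `(0, ∞)`, with the point itself removed. -/
theorem LocPwc.exists_left_const {f : ℝ → ℝ} (hf : LocPwc f) {a : ℝ} (ha : 0 < a) :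
    ∃ b < a, 0 ≤ b ∧ ∀ s ∈ Set.Ioo b a, ∀ t ∈ Set.Ioo b a, s ≤ t → f s = f t := by
  obtain ⟨D, hD⟩ := hf 0 a
  have h : ∀ᶠ b in 𝓝[<] a, ∀ d ∈ D, d < a → d < b := by
    rw [Filter.eventually_all_finset]
    intro d _
    by_cases hda : d < a
    · filter_upwards [Ioo_mem_nhdsLT hda] with b hb _ using hb.1
    · exact Eventually.of_forall fun _ h => absurd h hda
  obtain ⟨b, hb, hb0, hba⟩ := (h.and (Ioo_mem_nhdsLT ha)).exists
  refine ⟨b, hba, hb0.le, fun s hs t ht hst => hD s ?_ t ?_ hst fun d hd hdt => ?_⟩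
  · exact ⟨(hb0.trans hs.1).le, (hb0.trans hs.1).le, hs.2.le⟩
  · exact ⟨(hb0.trans ht.1).le, (hb0.trans ht.1).le, ht.2.le⟩
  · linarith [hb d hd (hdt.2.trans_lt ht.2), hdt.1, hs.1]

/-- The net rate is integrable up to a transition point; otherwise the integral defining
the trajectory would vanish there and at all later times. -/
theorem QueueTraj.intervalIntegrable_of_transitionPt {y c x : ℝ → ℝ} {a : ℝ}
    (hx : QueueTraj y c x) (ha : TransitionPt x a) :
    IntervalIntegrable (qrate y c x) volume 0 a := by
  obtain ⟨ha0, hxa, ε, hε, hpos⟩ := ha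
  by_contra hni
  have hni' : ¬ IntervalIntegrable (qrate y c x) volume 0 (a + ε) := fun h =>
    hni (h.mono_set (Set.uIcc_subset_uIcc_left (Set.mem_uIcc_of_le ha0 (by linarith))))
  have h1 := hx.2 a ha0
  have h2 := hx.2 (a + ε) (by linarith)
  rw [intervalIntegral.integral_undef hni] at h1
  rw [intervalIntegral.integral_undef hni'] at h2
  linarith [hpos (a + ε) ⟨by linarith, le_rfl⟩]

/-- If the net rate is integrable on `[0, u]` and equal to `q` on `(u, v)`, the queue
changes by `(v - u) * q` between `u` and `v`. -/
theorem QueueTraj.eq_add_of_qrate_eq {y c x : ℝ → ℝ} {u v q : ℝ} (hx : QueueTraj y c x)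
    (hu : 0 ≤ u) (huv : u ≤ v) (hi : IntervalIntegrable (qrate y c x) volume 0 u)
    (hq : ∀ r ∈ Set.Ioo u v, qrate y c x r = q) : x v = x u + (v - u) * q := by
  have hEq : Set.EqOn (fun _ => q) (qrate y c x) (Set.uIoo u v) := by
    rw [Set.uIoo_of_le huv]
    exact fun r hr => (hq r hr).symm
  have hi' : IntervalIntegrable (qrate y c x) volume u v :=
    intervalIntegrable_const.congr_uIoo hEq
  have h := intervalIntegral.integral_add_adjacent_intervals hi hi'
  have hc : ∫ r in u..v, qrate y c x r = (v - u) * q := by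
    rw [← intervalIntegral.integral_congr_uIoo hEq, intervalIntegral.integral_const,
      smul_eq_mul]
  linarith [hx.2 u hu, hx.2 v (hu.trans huv)]

/-- Every transition point `α > 0` of a queue trajectory is the left endpoint of a
maximal interval on which the inflow strictly exceeds the capacity: `y > c` on some
interval `(α, α + δ)`, while every left-neighborhood of `α` contains a time where
`y ≤ c`. -/
theorem transition_point_characterization (y c x : ℝ → ℝ) (α : ℝ)
    (hy_nn : ∀ t, 0 ≤ t → 0 ≤ y t) (hc_nn : ∀ t, 0 ≤ t → 0 ≤ c t)
    (hy_pwc : LocPwc y) (hc_pwc : LocPwc c)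
    (hx : QueueTraj y c x)
    (hα : 0 < α) (htp : TransitionPt x α) :
    (∃ d > 0, ∀ t ∈ Set.Ioo α (α + d), c t < y t) ∧
    (∀ ε : ℝ, 0 < ε → ε ≤ α → ∃ t ∈ Set.Ioo (α - ε) α, y t ≤ c t) := by
  have h_int := hx.intervalIntegrable_of_transitionPt htp
  obtain ⟨-, hxα, ε₀, hε₀, hpos⟩ := htp
  constructor
  · obtain ⟨b, hb, hyb⟩ := hy_pwc.exists_right_const hα.le
    obtain ⟨b', hb', hcb⟩ := hc_pwc.exists_right_const hα.le
    obtain ⟨v, hαv, hv⟩ := exists_between (lt_min (lt_min hb hb') (lt_add_of_pos_right α hε₀))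
    obtain ⟨⟨hvb, hvb'⟩, hvε⟩ : (v < b ∧ v < b') ∧ v < α + ε₀ := by simpa using hv
    have hxv := hx.eq_add_of_qrate_eq (q := y α - c α) hα.le hαv.le h_int fun r hr => by
      rw [qrate, if_pos (hpos r ⟨hr.1, (hr.2.trans hvε).le⟩), hyb r ⟨hr.1.le, hr.2.trans hvb⟩,
        hcb r ⟨hr.1.le, hr.2.trans hvb'⟩]
    have hq : 0 < y α - c α := by
      refine pos_of_mul_pos_right (a := v - α) ?_ (sub_nonneg.2 hαv.le)
      linarith [hpos v ⟨hαv, hvε.le⟩]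
    refine ⟨v - α, sub_pos.2 hαv, fun t ht => ?_⟩
    have htv : t < v := by linarith [ht.2]
    rw [hyb t ⟨ht.1.le, htv.trans hvb⟩, hcb t ⟨ht.1.le, htv.trans hvb'⟩]
    linarith
  · intro ε hε _
    by_contra! hlt
    obtain ⟨b, hb, hb0, hyb⟩ := hy_pwc.exists_left_const hα
    obtain ⟨b', hb', -, hcb⟩ := hc_pwc.exists_left_const hα
    obtain ⟨u, hu, huα⟩ := exists_between (max_lt (max_lt hb hb') (sub_lt_self α hε))
    obtain ⟨⟨hub, hub'⟩, huε⟩ : (b < u ∧ b' < u) ∧ α - ε < u := by simpa using hu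
    have hu0 : 0 ≤ u := hb0.trans hub.le
    have hyc := hlt u ⟨huε, huα⟩
    have hxα' := hx.eq_add_of_qrate_eq (q := y u - c u) hu0 huα.le
      (h_int.mono_set (Set.uIcc_subset_uIcc_left (Set.mem_uIcc_of_le hu0 huα.le)))
      fun r hr => by
        have hr_lt := hlt r ⟨huε.trans hr.1, hr.2⟩
        rw [qrate, max_eq_left (sub_nonneg.2 hr_lt.le), ite_self,
          hyb u ⟨hub, huα⟩ r ⟨hub.trans hr.1, hr.2⟩ hr.1.le,
          hcb u ⟨hub', huα⟩ r ⟨hub'.trans hr.1, hr.2⟩ hr.1.le]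
    linarith [hx.1 u hu0, mul_pos (sub_pos.2 huα) (sub_pos.2 hyc)]
end
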